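/- Decoherence-free subspaces are preserved: let c̄ ∈ Fin N → Bool and let ψ ∈ ℂ^X be a vector with Π_{c̄} ψ = ψ. Then for every t ≥ 0, the partial trace over the N ancilla qubits of E_t(|ψ⟩⟨ψ| ⊗ |1̄⟩⟨1̄|) equals |ψ⟩⟨ψ|. -/

import Mathlib

open Matrix Filter
open scoped Kronecker Topology

attribute [local instance] Matrix.normedAddCommGroup Matrix.normedSpace

noncomputable section

/-- The computational basis of `n` qubits, `X = {0,1}ⁿ`. -/
abbrev QubitBasis (n : ℕ) := Fin n → Bool

/-- Evaluation of the 3-literal clause with indices `i₁ i₂ i₃` and bits `b₁ b₂ b₃`: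
`C(x) = ¬(x i₁ = b₁ ∧ x i₂ = b₂ ∧ x i₃ = b₃)`. -/
def clauseEval {n : ℕ} (i₁ i₂ i₃ : Fin n) (b₁ b₂ b₃ : Bool) (x : QubitBasis n) : Bool :=
  ! (decide (x i₁ = b₁) && decide (x i₂ = b₂) && decide (x i₃ = b₃))

/-- The Lindblad operator `Lⱼ` attached to the `j`-th clause of an `N`-clause network:
`Lⱼ((x,ā),(y,b̄)) = 1` iff `x = y`, `Cⱼ(x) = false`, `ā j = false`, `b̄ j = true`, and
`ā k = b̄ k` for all `k ≠ j`. -/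
def jumpOpN {n N : ℕ} (C : Fin N → QubitBasis n → Bool) (j : Fin N) :
    Matrix (QubitBasis n × (Fin N → Bool)) (QubitBasis n × (Fin N → Bool)) ℂ :=
  Matrix.of fun p q =>
    if p.1 = q.1 ∧ C j p.1 = false ∧ p.2 j = false ∧ q.2 j = true ∧
        (∀ k, k ≠ j → p.2 k = q.2 k) then 1 else 0

/-- The Lindbladian `ℒ(ρ) = γ (L ρ L† − (1/2)(L†L ρ + ρ L†L))` as a linear endomorphism
of the matrix space. -/
def lindbladian {d : Type*} [Fintype d] [DecidableEq d] (γ : ℝ) (L : Matrix d d ℂ) :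
    Matrix d d ℂ →ₗ[ℂ] Matrix d d ℂ :=
  (γ : ℂ) • ((LinearMap.mulRight ℂ Lᴴ).comp (LinearMap.mulLeft ℂ L)
    - (1 / 2 : ℂ) • (LinearMap.mulLeft ℂ (Lᴴ * L) + LinearMap.mulRight ℂ (Lᴴ * L)))

/-- The evolution `E_t = exp(t·ℒ)`, the exponential of the endomorphism `ℒ`. -/
def evol {d : Type*} [Fintype d] [DecidableEq d]
    (L : Matrix d d ℂ →ₗ[ℂ] Matrix d d ℂ) (t : ℝ) :
    Matrix d d ℂ →L[ℂ] Matrix d d ℂ :=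
  haveI : IsTopologicalRing (Matrix d d ℂ →L[ℂ] Matrix d d ℂ) :=
    inferInstanceAs (IsTopologicalRing ((d → d → ℂ) →L[ℂ] (d → d → ℂ)))
  NormedSpace.exp ((t : ℂ) • LinearMap.toContinuousLinearMap L)

/-- The projector `Π_{c̄} = Σ_{x : C̄(x) = c̄} |x⟩⟨x|` onto the decoherence-free subspace
labelled by `c̄ ∈ {0,1}^N`. -/
def dfsProjN {n N : ℕ} (C : Fin N → QubitBasis n → Bool) (cb : Fin N → Bool) :
    Matrix (QubitBasis n) (QubitBasis n) ℂ :=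
  Matrix.diagonal fun x => if (fun j => C j x) = cb then 1 else 0

/-- Partial trace over the `N` ancilla qubits:
`(x,y) ↦ Σ_{ā} M((x,ā),(y,ā))`. -/
def ptraceAncillas {n N : ℕ}
    (M : Matrix (QubitBasis n × (Fin N → Bool)) (QubitBasis n × (Fin N → Bool)) ℂ) :
    Matrix (QubitBasis n) (QubitBasis n) ℂ :=
  Matrix.of fun x y => ∑ a : Fin N → Bool, M (x, a) (y, a)


lemma exp_functional {E : Type*} [NormedAddCommGroup E] [NormedSpace ℂ E] [CompleteSpace E]
    (A : E →L[ℂ] E) (f : E →L[ℂ] ℂ)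
    (K : Submodule ℂ E) (hK : ∀ v ∈ K, A v ∈ K) (hf : ∀ v ∈ K, f (A v) = 0)
    (v : E) (hv : v ∈ K) : f (NormedSpace.exp A v) = f v := by
  have hs := NormedSpace.exp_series_hasSum_exp' (𝕂 := ℂ) (𝔸 := E →L[ℂ] E) A
  have h1 : HasSum (fun k : ℕ => f (((k.factorial : ℂ)⁻¹ • A ^ k) v)) (f (NormedSpace.exp A v)) := by
    have := hs.mapL (ContinuousLinearMap.apply ℂ E v)
    exact this.mapL f
  have hpow : ∀ k, (A ^ k) v ∈ K := by
    intro k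
    induction k with
    | zero => simpa using hv
    | succ k ih =>
      rw [pow_succ']
      exact hK _ ih
  have h2 : HasSum (fun k : ℕ => f (((k.factorial : ℂ)⁻¹ • A ^ k) v)) (f v) := by
    have := hasSum_single (f := fun k : ℕ => f (((k.factorial : ℂ)⁻¹ • A ^ k) v)) 0 (by
      intro k hk
      obtain ⟨m, rfl⟩ := Nat.exists_eq_succ_of_ne_zero hk
      have : ((((m+1).factorial : ℂ)⁻¹ • A ^ (m+1)) v) =
          ((m+1).factorial : ℂ)⁻¹ • A ((A ^ m) v) := by
        rw [pow_succ']; rfl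
      simp only [Nat.succ_eq_add_one]
      rw [this, map_smul, hf _ (hpow m)]
      simp)
    simpa using this
  exact h1.unique h2

lemma evol_functional {d : Type*} [Fintype d] [DecidableEq d]
    (L : Matrix d d ℂ →ₗ[ℂ] Matrix d d ℂ) (t : ℝ) (f : Matrix d d ℂ →ₗ[ℂ] ℂ)
    (K : Submodule ℂ (Matrix d d ℂ)) (hK : ∀ v ∈ K, L v ∈ K) (hf : ∀ v ∈ K, f (L v) = 0)
    (v : Matrix d d ℂ) (hv : v ∈ K) : f (evol L t v) = f v := by
  have hAv : ∀ w, ((t : ℂ) • LinearMap.toContinuousLinearMap L) w = (t : ℂ) • L w := fun w => rfl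
  exact exp_functional (E := d → d → ℂ) ((t : ℂ) • LinearMap.toContinuousLinearMap L)
    (LinearMap.toContinuousLinearMap f) K
    (fun w hw => K.smul_mem _ (hK w hw))
    (fun w hw => by
      change f ((t : ℂ) • L w) = 0
      rw [map_smul, hf w hw, smul_zero]) v hv

section entries
variable {n N : ℕ} (C : Fin N → QubitBasis n → Bool) (j : Fin N)

lemma jump_apply (x y : QubitBasis n) (a b : Fin N → Bool) :
    jumpOpN C j (x, a) (y, b) =
      if C j x = false ∧ a j = false ∧ (y, b) = (x, Function.update a j true) then 1 else 0 := by
  unfold jumpOpN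
  simp only [Matrix.of_apply, Prod.mk.injEq, Function.eq_update_iff]
  congr 1
  apply propext
  constructor
  · rintro ⟨h1, h2, h3, h4, h5⟩
    exact ⟨h2, h3, h1.symm, h4, fun k hk => (h5 k hk).symm⟩
  · rintro ⟨h2, h3, h1, h4, h5⟩
    exact ⟨h1.symm, h2, h3, h4, fun k hk => (h5 k hk).symm⟩

lemma jump_apply' (x y : QubitBasis n) (a b : Fin N → Bool) :
    jumpOpN C j (x, a) (y, b) =
      if C j y = false ∧ b j = true ∧ (x, a) = (y, Function.update b j false) then 1 else 0 := by
  unfold jumpOpN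
  simp only [Matrix.of_apply, Prod.mk.injEq, Function.eq_update_iff]
  congr 1
  apply propext
  constructor
  · rintro ⟨rfl, h2, h3, h4, h5⟩
    exact ⟨h2, h4, rfl, h3, h5⟩
  · rintro ⟨h2, h3, rfl, h4, h5⟩
    exact ⟨rfl, h2, h4, h3, h5⟩

variable (M : Matrix (QubitBasis n × (Fin N → Bool)) (QubitBasis n × (Fin N → Bool)) ℂ)

lemma jump_mul (x : QubitBasis n) (a : Fin N → Bool) (q) :
    (jumpOpN C j * M) (x, a) q =
      if C j x = false ∧ a j = false then M (x, Function.update a j true) q else 0 := by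
  rw [Matrix.mul_apply, Finset.sum_eq_single (x, Function.update a j true)]
  · rw [jump_apply]; simp
  · rintro ⟨y, b⟩ - h
    rw [jump_apply, if_neg (fun h' => h h'.2.2), zero_mul]
  · simp

lemma jumpH_mul (x : QubitBasis n) (a : Fin N → Bool) (q) :
    ((jumpOpN C j)ᴴ * M) (x, a) q =
      if C j x = false ∧ a j = true then M (x, Function.update a j false) q else 0 := by
  rw [Matrix.mul_apply, Finset.sum_eq_single (x, Function.update a j false)]
  · rw [Matrix.conjTranspose_apply, jump_apply']
    by_cases h : C j x = false ∧ a j = true <;> simp [h]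
  · rintro ⟨y, b⟩ - h
    rw [Matrix.conjTranspose_apply, jump_apply', if_neg (fun h' => h h'.2.2), star_zero, zero_mul]
  · simp

lemma mul_jumpH (x : QubitBasis n) (a : Fin N → Bool) (q) :
    (M * (jumpOpN C j)ᴴ) q (x, a) =
      if C j x = false ∧ a j = false then M q (x, Function.update a j true) else 0 := by
  have h := jump_mul C j Mᴴ x a q
  have h2 : (M * (jumpOpN C j)ᴴ) = (jumpOpN C j * Mᴴ)ᴴ := by simp
  rw [h2, Matrix.conjTranspose_apply, h]
  split_ifs <;> simp

lemma mul_jump (x : QubitBasis n) (a : Fin N → Bool) (q) :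
    (M * jumpOpN C j) q (x, a) =
      if C j x = false ∧ a j = true then M q (x, Function.update a j false) else 0 := by
  have h := jumpH_mul C j Mᴴ x a q
  have h2 : (M * jumpOpN C j) = ((jumpOpN C j)ᴴ * Mᴴ)ᴴ := by simp
  rw [h2, Matrix.conjTranspose_apply, h]
  split_ifs <;> simp

lemma lind_apply (γ : ℝ) (x y : QubitBasis n) (a b : Fin N → Bool) :
    lindbladian γ (jumpOpN C j) M (x, a) (y, b) =
      (γ : ℂ) * ((if C j x = false ∧ a j = false ∧ C j y = false ∧ b j = false then
          M (x, Function.update a j true) (y, Function.update b j true) else 0)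
        - (1 / 2 : ℂ) * ((if C j x = false ∧ a j = true then M (x, a) (y, b) else 0)
          + (if C j y = false ∧ b j = true then M (x, a) (y, b) else 0))) := by
  have e : lindbladian γ (jumpOpN C j) M = (γ : ℂ) • (jumpOpN C j * M * (jumpOpN C j)ᴴ
      - (1 / 2 : ℂ) • ((jumpOpN C j)ᴴ * (jumpOpN C j * M)
        + (M * (jumpOpN C j)ᴴ) * jumpOpN C j)) := by
    rw [← Matrix.mul_assoc (jumpOpN C j)ᴴ, Matrix.mul_assoc M]; rfl
  rw [e]
  simp only [Matrix.smul_apply, Matrix.sub_apply, Matrix.add_apply, smul_eq_mul]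
  rw [mul_jumpH, jump_mul, jumpH_mul, jump_mul, mul_jump, mul_jumpH]
  have ha : a j = true → Function.update a j true = a := fun h => by
    rw [← h]; exact Function.update_eq_self j a
  have hb : b j = true → Function.update b j true = b := fun h => by
    rw [← h]; exact Function.update_eq_self j b
  simp only [Function.update_self, Function.update_idem]
  congr 1
  congr 1
  · split_ifs <;> simp_all
  · clear e
    congr 2
    · by_cases h : C j x = false ∧ a j = true
      · rw [ha h.2]; simp [h]
      · simp [h]
    · by_cases h : C j y = false ∧ b j = true
      · rw [hb h.2]; simp [h]
      · simp [h]

/-- partial-trace functional at entry `(x,y)` -/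
def ptF (x y : QubitBasis n) :
    Matrix (QubitBasis n × (Fin N → Bool)) (QubitBasis n × (Fin N → Bool)) ℂ →ₗ[ℂ] ℂ where
  toFun M := ∑ a, M (x, a) (y, a)
  map_add' A B := by simp [Finset.sum_add_distrib]
  map_smul' c A := by simp [Finset.mul_sum]

lemma flip_sum (g : (Fin N → Bool) → ℂ) :
    ∑ a : Fin N → Bool, (if a j = false then g (Function.update a j true) else 0)
      = ∑ a : Fin N → Bool, (if a j = true then g a else 0) := by
  have hinv : Function.Involutive (fun a : Fin N → Bool => Function.update a j (!a j)) := by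
    intro a; simp
  refine Fintype.sum_equiv hinv.toPerm _ _ fun a => ?_
  rcases h : a j <;> simp [Function.Involutive.toPerm, h]

lemma ptF_lind (γ : ℝ) (x y : QubitBasis n) (h : C j x = C j y) :
    ptF x y (lindbladian γ (jumpOpN C j) M) = 0 := by
  change ∑ a, lindbladian γ (jumpOpN C j) M (x, a) (y, a) = 0
  simp only [lind_apply, ← h]
  rw [← Finset.mul_sum, Finset.sum_sub_distrib]
  by_cases hx : C j x = false
  · simp only [hx, true_and, and_self]
    rw [flip_sum j (fun a => M (x, a) (y, a)), ← Finset.sum_sub_distrib, Finset.sum_eq_zero, mul_zero]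
    intro a _
    ring
  · simp [hx]

/-- matrices whose `(x,y)` block vanishes unless the clause values agree -/
def blockK (x y : QubitBasis n) :
    Submodule ℂ (Matrix (QubitBasis n × (Fin N → Bool)) (QubitBasis n × (Fin N → Bool)) ℂ) where
  carrier := {M | (∃ j, C j x ≠ C j y) → ∀ a b, M (x, a) (y, b) = 0}
  zero_mem' := by intro _ a b; rfl
  add_mem' := by
    intro A B hA hB h a b
    rw [Matrix.add_apply, hA h, hB h, add_zero]
  smul_mem' := by
    intro c A hA h a b
    rw [Matrix.smul_apply, hA h, smul_zero]

end entries

/-- decoherence-free subspaces are preserved: if `Π_{c̄} ψ = ψ` then for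
every `t ≥ 0` the partial trace over the ancillas of `E_t(|ψ⟩⟨ψ| ⊗ |1̄⟩⟨1̄|)` is `|ψ⟩⟨ψ|`. -/
theorem dfs_preserved {n N : ℕ} (hn : 1 ≤ n) (hN : 1 ≤ N)
    (i₁ i₂ i₃ : Fin N → Fin n)
    (h₁₂ : ∀ j, i₁ j ≠ i₂ j) (h₁₃ : ∀ j, i₁ j ≠ i₃ j) (h₂₃ : ∀ j, i₂ j ≠ i₃ j)
    (b₁ b₂ b₃ : Fin N → Bool) (γ : ℝ) (hγ : 0 < γ)
    (C : Fin N → QubitBasis n → Bool)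
    (hC : ∀ j, C j = clauseEval (i₁ j) (i₂ j) (i₃ j) (b₁ j) (b₂ j) (b₃ j))
    (cb : Fin N → Bool) (ψ : QubitBasis n → ℂ) (hψ : dfsProjN C cb *ᵥ ψ = ψ)
    (t : ℝ) (ht : 0 ≤ t) :
    ptraceAncillas
      (evol (∑ j, lindbladian γ (jumpOpN C j)) t
        (Matrix.vecMulVec ψ (star ψ) ⊗ₖ
          Matrix.single (fun _ => true) (fun _ => true) (1 : ℂ)))
      = Matrix.vecMulVec ψ (star ψ) := by
  ext x y
  have key := evol_functional (∑ j, lindbladian γ (jumpOpN C j)) t (ptF x y) (blockK C x y)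
    (by
      intro v hv h a b
      rw [LinearMap.sum_apply, Matrix.sum_apply]
      refine Finset.sum_eq_zero fun j _ => ?_
      rw [lind_apply, hv h, hv h]
      simp)
    (by
      intro v hv
      by_cases h : ∃ j, C j x ≠ C j y
      · refine Finset.sum_eq_zero fun a _ => ?_
        rw [LinearMap.sum_apply, Matrix.sum_apply]
        refine Finset.sum_eq_zero fun j _ => ?_
        rw [lind_apply, hv h, hv h]
        simp
      · push Not at h
        rw [LinearMap.sum_apply, map_sum]
        exact Finset.sum_eq_zero fun j _ => ptF_lind C j v γ x y (h j))
    (Matrix.vecMulVec ψ (star ψ) ⊗ₖ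
          Matrix.single (fun _ => true) (fun _ => true) (1 : ℂ))
    (by
      rintro ⟨j, hj⟩ a b
      have hz : ∀ z, (fun j => C j z) ≠ cb → ψ z = 0 := by
        intro z hz
        have := congrFun hψ z
        rw [dfsProjN, Matrix.mulVec_diagonal, if_neg hz, zero_mul] at this
        exact this.symm
      rw [Matrix.kroneckerMap_apply, Matrix.vecMulVec_apply]
      by_cases hx : (fun j => C j x) = cb
      · have hy : (fun j => C j y) ≠ cb := fun hy => hj (congrFun (hx.trans hy.symm) j)
        simp [hz y hy]
      · simp [hz x hx])
  refine key.trans ?_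
  change ∑ a, (Matrix.vecMulVec ψ (star ψ) ⊗ₖ
          Matrix.single (fun _ => true) (fun _ => true) (1 : ℂ)) (x, a) (y, a) = _
  simp only [Matrix.kroneckerMap_apply]
  rw [← Finset.mul_sum, Finset.sum_eq_single (fun _ => true)]
  · simp
  · intro a _ ha
    rw [Matrix.single_apply, if_neg (fun h => ha h.1.symm)]
  · simp
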